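/- Let (C¹, d₁) and (C², d₂) be acyclic cochain complexes of finite-dimensional complex inner product spaces, and let f_i : C²_i → C¹_{i+1} be linear maps satisfying f_{i+1} d_{2,i} + d_{1,i+1} f_i = 0 for all i. For t ∈ ℝ define the cochain complex (C, d(t)) by C_i := C¹_i ⊕ C²_i and d_i(t)(u, v) := (d_{1,i} u + t·f_i v, d_{2,i} v). Then for every t ∈ ℝ the complex (C, d(t)) is acyclic, and the function L(t) := (1/2) Σ_q (−1)^{q+1} q log det Δ_q(t), where Δ_q(t) are the Laplacians of (C, d(t)), is differentiable with derivative L′(t) = 0 for every t; in particular L is constant in t. -/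

import Mathlib

noncomputable section

open LinearMap

variable {C1 C2 : ℕ → Type}
  [∀ q, NormedAddCommGroup (C1 q)] [∀ q, InnerProductSpace ℂ (C1 q)]
  [∀ q, FiniteDimensional ℂ (C1 q)]
  [∀ q, NormedAddCommGroup (C2 q)] [∀ q, InnerProductSpace ℂ (C2 q)]
  [∀ q, FiniteDimensional ℂ (C2 q)]

instance (q : ℕ) : FiniteDimensional ℂ (WithLp 2 (C1 q × C2 q)) :=
  Module.Finite.equiv (WithLp.linearEquiv 2 ℂ (C1 q × C2 q)).symm

/-- The deformed differential `d_q(t) (u, v) = (d_{1,q} u + t f_q v, d_{2,q} v)` on the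
orthogonal direct sum `C¹_q ⊕ C²_q`. -/
def defD (d1 : ∀ q, C1 q →ₗ[ℂ] C1 (q + 1)) (d2 : ∀ q, C2 q →ₗ[ℂ] C2 (q + 1))
    (f : ∀ q, C2 q →ₗ[ℂ] C1 (q + 1)) (t : ℝ) (q : ℕ) :
    WithLp 2 (C1 q × C2 q) →ₗ[ℂ] WithLp 2 (C1 (q + 1) × C2 (q + 1)) :=
  (WithLp.linearEquiv 2 ℂ (C1 (q + 1) × C2 (q + 1))).symm.toLinearMap ∘ₗ
    (((d1 q).comp (LinearMap.fst ℂ (C1 q) (C2 q)) +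
        ((t : ℂ) • f q).comp (LinearMap.snd ℂ (C1 q) (C2 q))).prod
      ((d2 q).comp (LinearMap.snd ℂ (C1 q) (C2 q)))) ∘ₗ
    (WithLp.linearEquiv 2 ℂ (C1 q × C2 q)).toLinearMap

/-- The Laplacians `Δ_q(t) = d_q(t)^* d_q(t) + d_{q-1}(t) d_{q-1}(t)^*` of the deformed
complex `(C, d(t))`. -/
def defLap (d1 : ∀ q, C1 q →ₗ[ℂ] C1 (q + 1)) (d2 : ∀ q, C2 q →ₗ[ℂ] C2 (q + 1))
    (f : ∀ q, C2 q →ₗ[ℂ] C1 (q + 1)) (t : ℝ) :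
    ∀ q, WithLp 2 (C1 q × C2 q) →ₗ[ℂ] WithLp 2 (C1 q × C2 q)
  | 0 => (LinearMap.adjoint (defD d1 d2 f t 0)).comp (defD d1 d2 f t 0)
  | (q + 1) =>
      (LinearMap.adjoint (defD d1 d2 f t (q + 1))).comp (defD d1 d2 f t (q + 1)) +
        (defD d1 d2 f t q).comp (LinearMap.adjoint (defD d1 d2 f t q))

/-- `L(t) = (1/2) Σ_q (-1)^{q+1} q log det Δ_q(t)`. -/
def defL (N : ℕ) (d1 : ∀ q, C1 q →ₗ[ℂ] C1 (q + 1)) (d2 : ∀ q, C2 q →ₗ[ℂ] C2 (q + 1))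
    (f : ∀ q, C2 q →ₗ[ℂ] C1 (q + 1)) (t : ℝ) : ℝ :=
  (1 / 2) * ∑ q ∈ Finset.range (N + 1),
      (-1 : ℝ) ^ (q + 1) * (q : ℝ) * Real.log ((LinearMap.det (defLap d1 d2 f t q)).re)

section Helpers

lemma aux_trace_adjoint {V : Type} [NormedAddCommGroup V] [InnerProductSpace ℂ V]
    [FiniteDimensional ℂ V] (A : V →ₗ[ℂ] V) :
    LinearMap.trace ℂ V (LinearMap.adjoint A) = (starRingEnd ℂ) (LinearMap.trace ℂ V A) := by
  rw [LinearMap.trace_eq_sum_inner _ (stdOrthonormalBasis ℂ V),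
    LinearMap.trace_eq_sum_inner _ (stdOrthonormalBasis ℂ V), map_sum]
  refine Finset.sum_congr rfl fun i _ => ?_
  rw [LinearMap.adjoint_inner_right, inner_conj_symm]

lemma aux_matrix_det_diff {n : ℕ} (A B C : Matrix (Fin n) (Fin n) ℂ) :
    HasDerivAt (fun s : ℝ => (A + (s : ℂ) • B + ((s : ℂ) ^ 2) • C).det)
      (deriv (fun s : ℝ => (A + (s : ℂ) • B).det) 0) 0 := by
  let φ : (Fin n → Fin n → ℂ) → ℂ := fun M => Matrix.det (Matrix.of M)
  have hφ : Differentiable ℝ φ := by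
    intro M
    simp only [φ, Matrix.det_apply, Matrix.of_apply]
    fun_prop
  have h1 : HasDerivAt (fun s : ℝ => (fun i j => A i j + (s : ℂ) * B i j + (s : ℂ) ^ 2 * C i j :
      Fin n → Fin n → ℂ)) (fun i j => B i j) 0 := by
    rw [hasDerivAt_pi]; intro i
    rw [hasDerivAt_pi]; intro j
    have h0 : HasDerivAt (fun s : ℝ => (s : ℂ)) 1 0 := Complex.ofRealCLM.hasDerivAt
    have := ((h0.mul_const (B i j)).const_add (A i j)).add ((h0.pow 2).mul_const (C i j))
    convert! this using 1
    simp
  have h2 : HasDerivAt (fun s : ℝ => (fun i j => A i j + (s : ℂ) * B i j :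
      Fin n → Fin n → ℂ)) (fun i j => B i j) 0 := by
    rw [hasDerivAt_pi]; intro i
    rw [hasDerivAt_pi]; intro j
    have h0 : HasDerivAt (fun s : ℝ => (s : ℂ)) 1 0 := Complex.ofRealCLM.hasDerivAt
    have := ((h0.mul_const (B i j)).const_add (A i j))
    convert! this using 1
    simp
  have k1 := (hφ _).hasFDerivAt.comp_hasDerivAt (0 : ℝ) h1
  have k2 := (hφ _).hasFDerivAt.comp_hasDerivAt (0 : ℝ) h2
  have e2 : (fun s : ℝ => (A + (s : ℂ) • B).det) = φ ∘ (fun s : ℝ => (fun i j =>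
      A i j + (s : ℂ) * B i j : Fin n → Fin n → ℂ)) := by
    funext s; rfl
  have e1 : (fun s : ℝ => (A + (s : ℂ) • B + ((s : ℂ) ^ 2) • C).det) = φ ∘ (fun s : ℝ => (fun i j =>
      A i j + (s : ℂ) * B i j + (s : ℂ) ^ 2 * C i j : Fin n → Fin n → ℂ)) := by
    funext s; rfl
  rw [e2, k2.deriv, e1]
  convert! k1 using 4
  simp

lemma aux_matrix_det_deriv {n : ℕ} (M C : Matrix (Fin n) (Fin n) ℂ) :
    HasDerivAt (fun s : ℝ => (1 + (s : ℂ) • M + ((s : ℂ) ^ 2) • C).det) M.trace 0 := by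
  have h := aux_matrix_det_diff 1 M C
  have h0 : HasDerivAt (fun s : ℝ => (s : ℂ)) 1 0 := Complex.ofRealCLM.hasDerivAt
  have hP : HasDerivAt (fun s : ℝ => ((Polynomial.X : Polynomial ℂ) • M.map Polynomial.C + 1 :
      Matrix (Fin n) (Fin n) (Polynomial ℂ)).det.eval (s : ℂ)) M.trace 0 := by
    have := (Polynomial.hasDerivAt ((1 + (Polynomial.X : Polynomial ℂ) • M.map Polynomial.C :
      Matrix (Fin n) (Fin n) (Polynomial ℂ)).det) ((0 : ℝ) : ℂ)).comp (0 : ℝ) h0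
    rw [Complex.ofReal_zero, Matrix.derivative_det_one_add_X_smul, mul_one] at this
    rw [add_comm]
    exact this
  have e : (fun s : ℝ => (1 + (s : ℂ) • M).det) = (fun s : ℝ =>
      ((Polynomial.X : Polynomial ℂ) • M.map Polynomial.C + 1 :
      Matrix (Fin n) (Fin n) (Polynomial ℂ)).det.eval (s : ℂ)) := by
    funext s
    rw [← Polynomial.coe_evalRingHom, RingHom.map_det]
    congr 1
    ext i j
    by_cases hij : i = j
    · subst hij
      simp
      ring
    · simp [Matrix.one_apply, hij]
      try ring
  rw [e, hP.deriv] at h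
  exact h

lemma aux_det_deriv {V : Type} [NormedAddCommGroup V] [InnerProductSpace ℂ V]
    [FiniteDimensional ℂ V] (A G B C : V →ₗ[ℂ] V) (hAG : A ∘ₗ G = LinearMap.id) :
    HasDerivAt (fun s : ℝ => LinearMap.det (A + (s : ℂ) • B + ((s : ℂ) ^ 2) • C))
      (LinearMap.det A * LinearMap.trace ℂ V (G ∘ₗ B)) 0 := by
  let b := Module.finBasis ℂ V
  have h := aux_matrix_det_deriv (LinearMap.toMatrix b b (G ∘ₗ B)) (LinearMap.toMatrix b b (G ∘ₗ C))
  have h2 := h.const_mul (LinearMap.det A)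
  rw [LinearMap.trace_eq_matrix_trace ℂ b]
  convert! h2 using 1
  funext s
  have e : A + (s : ℂ) • B + ((s : ℂ) ^ 2) • C =
      A ∘ₗ (LinearMap.id + (s : ℂ) • (G ∘ₗ B) + ((s : ℂ) ^ 2) • (G ∘ₗ C)) := by
    rw [LinearMap.comp_add, LinearMap.comp_add, LinearMap.comp_smul, LinearMap.comp_smul,
      ← LinearMap.comp_assoc, ← LinearMap.comp_assoc, hAG]
    simp
  rw [e, LinearMap.det_comp, ← LinearMap.det_toMatrix b (LinearMap.id + _ + _)]
  rw [map_add, map_add, map_smul, map_smul, LinearMap.toMatrix_id]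

lemma aux_det_pos {V : Type} [NormedAddCommGroup V] [InnerProductSpace ℂ V]
    [FiniteDimensional ℂ V] (A G : V →ₗ[ℂ] V) (hA : A.IsPositive)
    (hAG : A ∘ₗ G = LinearMap.id) :
    0 < (LinearMap.det A).re ∧ (LinearMap.det A).im = 0 := by
  have hdet : LinearMap.det A ≠ 0 := by
    intro h0
    have := congrArg LinearMap.det hAG
    rw [LinearMap.det_comp, h0] at this
    simp at this
  have h := hA.isSymmetric.det_eq_prod_eigenvalues rfl
  have hn := fun i => hA.nonneg_eigenvalues rfl i
  have h' : LinearMap.det A = ((∏ i, hA.isSymmetric.eigenvalues rfl i : ℝ) : ℂ) := by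
    rw [h, Complex.ofReal_prod]; rfl
  rw [h'] at hdet ⊢
  refine ⟨?_, Complex.ofReal_im _⟩
  rw [Complex.ofReal_re]
  exact lt_of_le_of_ne (Finset.prod_nonneg fun i _ => hn i) (fun h => hdet (by rw [← h]; simp))

variable {E : ℕ → Type} [∀ q, NormedAddCommGroup (E q)] [∀ q, InnerProductSpace ℂ (E q)]
  [∀ q, FiniteDimensional ℂ (E q)]

/-- The Laplacians of a complex. -/
def auxLap (d : ∀ q, E q →ₗ[ℂ] E (q + 1)) : ∀ q, E q →ₗ[ℂ] E q
  | 0 => (LinearMap.adjoint (d 0)).comp (d 0)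
  | (q + 1) => (LinearMap.adjoint (d (q + 1))).comp (d (q + 1)) +
        (d q).comp (LinearMap.adjoint (d q))

lemma auxLap_pos (d : ∀ q, E q →ₗ[ℂ] E (q + 1)) (q : ℕ) : (auxLap d q).IsPositive := by
  cases q with
  | zero => exact LinearMap.isPositive_adjoint_comp_self _
  | succ q =>
    exact (LinearMap.isPositive_adjoint_comp_self _).add (LinearMap.isPositive_self_comp_adjoint _)

lemma auxLap_ker (d : ∀ q, E q →ₗ[ℂ] E (q + 1))
    (hac : LinearMap.ker (d 0) = ⊥ ∧ ∀ q, LinearMap.ker (d (q + 1)) = LinearMap.range (d q))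
    (q : ℕ) : LinearMap.ker (auxLap d q) = ⊥ := by
  rw [LinearMap.ker_eq_bot']
  intro x hx
  cases q with
  | zero =>
    have h : inner ℂ (d 0 x) (d 0 x) = 0 := by
      rw [← LinearMap.adjoint_inner_left]
      change inner ℂ (auxLap d 0 x) x = 0
      rw [hx, inner_zero_left]
    exact LinearMap.ker_eq_bot'.1 hac.1 x (inner_self_eq_zero.1 h)
  | succ q =>
    have h : inner ℂ (d (q + 1) x) (d (q + 1) x) +
        inner ℂ (LinearMap.adjoint (d q) x) (LinearMap.adjoint (d q) x) = 0 := by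
      rw [← LinearMap.adjoint_inner_left, LinearMap.adjoint_inner_right, ← inner_add_left]
      change inner ℂ (auxLap d (q + 1) x) x = 0
      rw [hx, inner_zero_left]
    have h' : ‖d (q + 1) x‖ ^ 2 + ‖LinearMap.adjoint (d q) x‖ ^ 2 = 0 := by
      rw [inner_self_eq_norm_sq_to_K, inner_self_eq_norm_sq_to_K] at h
      have h2 := congrArg Complex.re h
      simpa [← Complex.ofReal_pow] using h2
    have h1 : d (q + 1) x = 0 := by
      rw [← norm_eq_zero]; nlinarith [sq_nonneg ‖d (q + 1) x‖, sq_nonneg ‖LinearMap.adjoint (d q) x‖]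
    have h2 : LinearMap.adjoint (d q) x = 0 := by
      rw [← norm_eq_zero]; nlinarith [sq_nonneg ‖d (q + 1) x‖, sq_nonneg ‖LinearMap.adjoint (d q) x‖]
    have h3 : x ∈ LinearMap.range (d q) := by
      rw [← hac.2 q]; exact h1
    obtain ⟨y, rfl⟩ := h3
    rw [← inner_self_eq_zero (𝕜 := ℂ), ← LinearMap.adjoint_inner_left, h2, inner_zero_left]

lemma auxLap_inv (d : ∀ q, E q →ₗ[ℂ] E (q + 1))
    (hac : LinearMap.ker (d 0) = ⊥ ∧ ∀ q, LinearMap.ker (d (q + 1)) = LinearMap.range (d q)) :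
    ∃ G : ∀ q, E q →ₗ[ℂ] E q, (∀ q, auxLap d q ∘ₗ G q = LinearMap.id) ∧
      (∀ q, G q ∘ₗ auxLap d q = LinearMap.id) := by
  have h := fun q => LinearMap.ker_eq_bot.1 (auxLap_ker d hac q)
  let e := fun q => LinearEquiv.ofInjectiveEndo (auxLap d q) (h q)
  refine ⟨fun q => (e q).symm.toLinearMap, fun q => ?_, fun q => ?_⟩
  · ext x
    exact (e q).apply_symm_apply x
  · ext x
    exact (e q).symm_apply_apply x

lemma auxLap_comm (d : ∀ q, E q →ₗ[ℂ] E (q + 1)) (hdd : ∀ q, d (q + 1) ∘ₗ d q = 0) (q : ℕ) :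
    d q ∘ₗ auxLap d q = auxLap d (q + 1) ∘ₗ d q := by
  cases q with
  | zero =>
    simp only [auxLap, LinearMap.add_comp, LinearMap.comp_assoc, hdd, LinearMap.comp_zero, zero_add]
  | succ q =>
    simp only [auxLap, LinearMap.add_comp, LinearMap.comp_add, LinearMap.comp_assoc, hdd,
      LinearMap.comp_zero, zero_add]
    rw [← LinearMap.comp_assoc (LinearMap.adjoint (d q)) (d q) (d (q + 1)), hdd]
    simp

lemma auxG_comm (d : ∀ q, E q →ₗ[ℂ] E (q + 1)) (hdd : ∀ q, d (q + 1) ∘ₗ d q = 0)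
    (G : ∀ q, E q →ₗ[ℂ] E q) (hG : ∀ q, auxLap d q ∘ₗ G q = LinearMap.id)
    (hG' : ∀ q, G q ∘ₗ auxLap d q = LinearMap.id) (q : ℕ) :
    d q ∘ₗ G q = G (q + 1) ∘ₗ d q := by
  calc d q ∘ₗ G q = (G (q + 1) ∘ₗ auxLap d (q + 1)) ∘ₗ d q ∘ₗ G q := by
        rw [hG', LinearMap.id_comp]
    _ = G (q + 1) ∘ₗ (auxLap d (q + 1) ∘ₗ d q) ∘ₗ G q := by
        simp only [LinearMap.comp_assoc]
    _ = G (q + 1) ∘ₗ d q := by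
        rw [← auxLap_comm d hdd, LinearMap.comp_assoc, hG, LinearMap.comp_id]

lemma auxG_adj (d : ∀ q, E q →ₗ[ℂ] E (q + 1))
    (G : ∀ q, E q →ₗ[ℂ] E q) (hG : ∀ q, auxLap d q ∘ₗ G q = LinearMap.id)
    (hG' : ∀ q, G q ∘ₗ auxLap d q = LinearMap.id) (q : ℕ) :
    LinearMap.adjoint (G q) = G q := by
  have hs : LinearMap.adjoint (auxLap d q) = auxLap d q := (auxLap_pos d q).adjoint_eq
  have h := congrArg LinearMap.adjoint (hG q)
  rw [LinearMap.adjoint_comp, hs, LinearMap.adjoint_id] at h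
  calc LinearMap.adjoint (G q) = LinearMap.adjoint (G q) ∘ₗ (auxLap d q ∘ₗ G q) := by
        rw [hG, LinearMap.comp_id]
    _ = G q := by rw [← LinearMap.comp_assoc, h, LinearMap.id_comp]

lemma auxG_comm' (d : ∀ q, E q →ₗ[ℂ] E (q + 1)) (hdd : ∀ q, d (q + 1) ∘ₗ d q = 0)
    (G : ∀ q, E q →ₗ[ℂ] E q) (hG : ∀ q, auxLap d q ∘ₗ G q = LinearMap.id)
    (hG' : ∀ q, G q ∘ₗ auxLap d q = LinearMap.id) (q : ℕ) :
    LinearMap.adjoint (d q) ∘ₗ G (q + 1) = G q ∘ₗ LinearMap.adjoint (d q) := by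
  have h := congrArg LinearMap.adjoint (auxG_comm d hdd G hG hG' q)
  rw [LinearMap.adjoint_comp, LinearMap.adjoint_comp, auxG_adj d G hG hG',
    auxG_adj d G hG hG'] at h
  exact h.symm

/-- An acyclic complex has a contraction. -/
lemma aux_contraction (d : ∀ q, E q →ₗ[ℂ] E (q + 1)) (hdd : ∀ q, d (q + 1) ∘ₗ d q = 0)
    (hac : LinearMap.ker (d 0) = ⊥ ∧ ∀ q, LinearMap.ker (d (q + 1)) = LinearMap.range (d q)) :
    ∃ δ : ∀ q, E (q + 1) →ₗ[ℂ] E q, δ 0 ∘ₗ d 0 = LinearMap.id ∧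
      ∀ q, d q ∘ₗ δ q + δ (q + 1) ∘ₗ d (q + 1) = LinearMap.id := by
  obtain ⟨G, hG, hG'⟩ := auxLap_inv d hac
  refine ⟨fun q => G q ∘ₗ LinearMap.adjoint (d q), ?_, fun q => ?_⟩
  · rw [LinearMap.comp_assoc]; exact hG' 0
  · rw [← LinearMap.comp_assoc, auxG_comm d hdd G hG hG', LinearMap.comp_assoc,
      LinearMap.comp_assoc, ← LinearMap.comp_add, add_comm (d q ∘ₗ _)]
    exact hG' (q + 1)

/-- The derivative of the Laplacian in degree `q + 1`. -/
def auxB (d F : ∀ q, E q →ₗ[ℂ] E (q + 1)) (q : ℕ) : E (q + 1) →ₗ[ℂ] E (q + 1) :=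
  LinearMap.adjoint (F (q + 1)) ∘ₗ d (q + 1) + LinearMap.adjoint (d (q + 1)) ∘ₗ F (q + 1) +
    F q ∘ₗ LinearMap.adjoint (d q) + d q ∘ₗ LinearMap.adjoint (F q)

lemma aux_traceB (d F : ∀ q, E q →ₗ[ℂ] E (q + 1)) (hdd : ∀ q, d (q + 1) ∘ₗ d q = 0)
    (G : ∀ q, E q →ₗ[ℂ] E q) (hG : ∀ q, auxLap d q ∘ₗ G q = LinearMap.id)
    (hG' : ∀ q, G q ∘ₗ auxLap d q = LinearMap.id) (q : ℕ) :
    (LinearMap.trace ℂ _ (G (q + 1) ∘ₗ auxB d F q)).re =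
      2 * (LinearMap.trace ℂ _ (G (q + 1) ∘ₗ LinearMap.adjoint (d (q + 1)) ∘ₗ F (q + 1))).re +
      2 * (LinearMap.trace ℂ _ (G q ∘ₗ LinearMap.adjoint (d q) ∘ₗ F q)).re := by
  have e1 : LinearMap.trace ℂ _ (G (q + 1) ∘ₗ LinearMap.adjoint (F (q + 1)) ∘ₗ d (q + 1)) =
      (starRingEnd ℂ) (LinearMap.trace ℂ _
        (G (q + 1) ∘ₗ LinearMap.adjoint (d (q + 1)) ∘ₗ F (q + 1))) := by
    rw [← aux_trace_adjoint]
    simp only [LinearMap.adjoint_comp, LinearMap.adjoint_adjoint, auxG_adj d G hG hG']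
    rw [LinearMap.trace_comp_comm']
  have e2 : LinearMap.trace ℂ _ (G (q + 1) ∘ₗ F q ∘ₗ LinearMap.adjoint (d q)) =
      LinearMap.trace ℂ _ (G q ∘ₗ LinearMap.adjoint (d q) ∘ₗ F q) := by
    rw [← LinearMap.comp_assoc, LinearMap.trace_comp_comm', ← LinearMap.comp_assoc,
      auxG_comm' d hdd G hG hG', LinearMap.comp_assoc]
  have e3 : LinearMap.trace ℂ _ (G (q + 1) ∘ₗ d q ∘ₗ LinearMap.adjoint (F q)) =
      (starRingEnd ℂ) (LinearMap.trace ℂ _ (G q ∘ₗ LinearMap.adjoint (d q) ∘ₗ F q)) := by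
    rw [← e2, ← aux_trace_adjoint]
    simp only [LinearMap.adjoint_comp, LinearMap.adjoint_adjoint, auxG_adj d G hG hG']
    rw [LinearMap.trace_comp_comm']
  simp only [auxB, LinearMap.comp_add, map_add, e1, e2, e3, Complex.add_re, Complex.conj_re]
  ring

lemma aux_trace_a (d F : ∀ q, E q →ₗ[ℂ] E (q + 1)) (hdd : ∀ q, d (q + 1) ∘ₗ d q = 0)
    (G : ∀ q, E q →ₗ[ℂ] E q) (hG : ∀ q, auxLap d q ∘ₗ G q = LinearMap.id)
    (hG' : ∀ q, G q ∘ₗ auxLap d q = LinearMap.id)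
    (H : ∀ q, E q →ₗ[ℂ] E q) (hH : ∀ q, LinearMap.trace ℂ _ (H q) = 0)
    (hF : ∀ q, F q = d q ∘ₗ H q - H (q + 1) ∘ₗ d q) (q : ℕ) :
    LinearMap.trace ℂ _ (G q ∘ₗ LinearMap.adjoint (d q) ∘ₗ F q) =
      LinearMap.trace ℂ _ (G q ∘ₗ LinearMap.adjoint (d q) ∘ₗ d q ∘ₗ H q) +
      LinearMap.trace ℂ _
        (G (q + 1) ∘ₗ LinearMap.adjoint (d (q + 1)) ∘ₗ d (q + 1) ∘ₗ H (q + 1)) := by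
  have e1 : LinearMap.trace ℂ _ (G q ∘ₗ LinearMap.adjoint (d q) ∘ₗ H (q + 1) ∘ₗ d q) =
      LinearMap.trace ℂ _ (G (q + 1) ∘ₗ d q ∘ₗ LinearMap.adjoint (d q) ∘ₗ H (q + 1)) := by
    rw [← LinearMap.comp_assoc (LinearMap.adjoint (d q) ∘ₗ H (q + 1)) (d q) (G (q + 1)),
      ← auxG_comm d hdd G hG hG', LinearMap.comp_assoc,
      LinearMap.trace_comp_comm' (G q ∘ₗ LinearMap.adjoint (d q) ∘ₗ H (q + 1)) (d q)]
    simp only [LinearMap.comp_assoc]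
  have e2 : LinearMap.trace ℂ _
        (G (q + 1) ∘ₗ LinearMap.adjoint (d (q + 1)) ∘ₗ d (q + 1) ∘ₗ H (q + 1)) +
      LinearMap.trace ℂ _ (G (q + 1) ∘ₗ d q ∘ₗ LinearMap.adjoint (d q) ∘ₗ H (q + 1)) = 0 := by
    rw [← map_add, ← hH (q + 1)]
    congr 1
    rw [← LinearMap.comp_add, ← LinearMap.comp_assoc (H (q + 1)),
      ← LinearMap.comp_assoc (H (q + 1)), ← LinearMap.add_comp]
    change G (q + 1) ∘ₗ auxLap d (q + 1) ∘ₗ H (q + 1) = _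
    rw [← LinearMap.comp_assoc, hG', LinearMap.id_comp]
  rw [hF, LinearMap.comp_sub, LinearMap.comp_sub, map_sub, e1]
  linear_combination -e2

lemma aux_sum (p : ℕ → ℝ) (n : ℕ) :
    ∑ q ∈ Finset.range n, (-1 : ℝ) ^ q * (q + 1) * (p (q + 2) + 2 * p (q + 1) + p q) =
      p 0 + (-1) ^ (n + 1) * (n * p (n + 1) + (n + 1) * p n) := by
  induction n with
  | zero => simp
  | succ n ih =>
    rw [Finset.sum_range_succ, ih]
    push_cast
    ring

lemma aux_key (N : ℕ) (d F : ∀ q, E q →ₗ[ℂ] E (q + 1)) (hdd : ∀ q, d (q + 1) ∘ₗ d q = 0)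
    (htriv : ∀ q, N < q → ∀ x : E q, x = 0)
    (G : ∀ q, E q →ₗ[ℂ] E q) (hG : ∀ q, auxLap d q ∘ₗ G q = LinearMap.id)
    (hG' : ∀ q, G q ∘ₗ auxLap d q = LinearMap.id)
    (H : ∀ q, E q →ₗ[ℂ] E q) (hH : ∀ q, LinearMap.trace ℂ _ (H q) = 0)
    (hF : ∀ q, F q = d q ∘ₗ H q - H (q + 1) ∘ₗ d q) :
    ∑ q ∈ Finset.range N, (-1 : ℝ) ^ q * (q + 1) *
      (LinearMap.trace ℂ _ (G (q + 1) ∘ₗ auxB d F q)).re = 0 := by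
  let p : ℕ → ℝ := fun q =>
    (LinearMap.trace ℂ _ (G q ∘ₗ LinearMap.adjoint (d q) ∘ₗ d q ∘ₗ H q)).re
  have hp0 : p 0 = 0 := by
    have : G 0 ∘ₗ LinearMap.adjoint (d 0) ∘ₗ d 0 ∘ₗ H 0 = H 0 := by
      rw [← LinearMap.comp_assoc (H 0)]
      change G 0 ∘ₗ auxLap d 0 ∘ₗ H 0 = _
      rw [← LinearMap.comp_assoc, hG', LinearMap.id_comp]
    simp only [p, this, hH, Complex.zero_re]
  have hpN : ∀ q, N ≤ q → p q = 0 := by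
    intro q hq
    have : d q = 0 := by
      ext x
      exact htriv (q + 1) (by omega) _
    simp [p, this]
  have h : ∀ q, (LinearMap.trace ℂ _ (G (q + 1) ∘ₗ auxB d F q)).re =
      2 * (p (q + 2) + 2 * p (q + 1) + p q) := by
    intro q
    rw [aux_traceB d F hdd G hG hG', aux_trace_a d F hdd G hG hG' H hH hF,
      aux_trace_a d F hdd G hG hG' H hH hF, Complex.add_re, Complex.add_re]
    simp only [p]
    ring
  have hs := aux_sum p N
  rw [hp0, hpN N le_rfl, hpN (N + 1) (by omega)] at hs
  calc _ = 2 * ∑ q ∈ Finset.range N,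
      (-1 : ℝ) ^ q * (q + 1) * (p (q + 2) + 2 * p (q + 1) + p q) := by
        rw [Finset.mul_sum]
        refine Finset.sum_congr rfl fun q _ => ?_
        rw [h]; ring
    _ = 0 := by rw [hs]; simp

lemma auxLap_expand (d F : ∀ q, E q →ₗ[ℂ] E (q + 1)) (s : ℝ) (q : ℕ) :
    auxLap (fun q => d q + (s : ℂ) • F q) (q + 1) =
      auxLap d (q + 1) + (s : ℂ) • auxB d F q + ((s : ℂ) ^ 2) • auxLap F (q + 1) := by
  simp only [auxLap, auxB, map_add, map_smulₛₗ, LinearMap.add_comp, LinearMap.comp_add,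
    LinearMap.smul_comp, LinearMap.comp_smul, Complex.conj_ofReal]
  module

lemma aux_deriv (N : ℕ) (d F : ∀ q, E q →ₗ[ℂ] E (q + 1)) (hdd : ∀ q, d (q + 1) ∘ₗ d q = 0)
    (htriv : ∀ q, N < q → ∀ x : E q, x = 0)
    (hac : LinearMap.ker (d 0) = ⊥ ∧ ∀ q, LinearMap.ker (d (q + 1)) = LinearMap.range (d q))
    (H : ∀ q, E q →ₗ[ℂ] E q) (hH : ∀ q, LinearMap.trace ℂ _ (H q) = 0)
    (hF : ∀ q, F q = d q ∘ₗ H q - H (q + 1) ∘ₗ d q) :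
    HasDerivAt (fun s : ℝ => (1 / 2) * ∑ q ∈ Finset.range (N + 1), (-1 : ℝ) ^ (q + 1) * (q : ℝ) *
      Real.log ((LinearMap.det (auxLap (fun q => d q + (s : ℂ) • F q) q)).re)) 0 0 := by
  obtain ⟨G, hG, hG'⟩ := auxLap_inv d hac
  have key := aux_key N d F hdd htriv G hG hG' H hH hF
  have h1 : ∀ q, HasDerivAt (fun s : ℝ =>
      Real.log ((LinearMap.det (auxLap (fun q => d q + (s : ℂ) • F q) (q + 1))).re))
      (LinearMap.trace ℂ _ (G (q + 1) ∘ₗ auxB d F q)).re 0 := by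
    intro q
    obtain ⟨hpos, him⟩ := aux_det_pos _ _ (auxLap_pos d (q + 1)) (hG (q + 1))
    have h := aux_det_deriv (auxLap d (q + 1)) (G (q + 1)) (auxB d F q) (auxLap F (q + 1))
      (hG (q + 1))
    have hre := Complex.reCLM.hasFDerivAt.comp_hasDerivAt (0 : ℝ) h
    simp only [auxLap_expand]
    have hlog := hre.log (by simpa using hpos.ne')
    convert! hlog using 1
    simp only [Complex.reCLM_apply, Complex.mul_re, him, zero_mul, sub_zero, Function.comp,
      Complex.ofReal_zero, zero_smul, add_zero, ne_eq, OfNat.ofNat_ne_zero, not_false_eq_true,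
      zero_pow]
    field_simp
  have h2 := HasDerivAt.fun_sum (u := Finset.range N)
    (fun q _ => (h1 q).const_mul ((-1 : ℝ) ^ q * (q + 1)))
  rw [key] at h2
  have h3 := h2.const_mul (1 / 2 : ℝ)
  rw [mul_zero] at h3
  convert! h3 using 1
  funext s
  rw [Finset.sum_range_succ']
  congr 1
  simp only [CharP.cast_eq_zero, mul_zero, zero_mul, add_zero]
  refine Finset.sum_congr rfl fun q _ => ?_
  push_cast
  ring

end Helpers

lemma defD_apply (d1 : ∀ q, C1 q →ₗ[ℂ] C1 (q + 1)) (d2 : ∀ q, C2 q →ₗ[ℂ] C2 (q + 1))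
    (f : ∀ q, C2 q →ₗ[ℂ] C1 (q + 1)) (t : ℝ) (q : ℕ) (x : WithLp 2 (C1 q × C2 q)) :
    defD d1 d2 f t q x = WithLp.toLp 2 (d1 q x.fst + (t : ℂ) • f q x.snd, d2 q x.snd) := rfl

lemma defLap_eq (d1 : ∀ q, C1 q →ₗ[ℂ] C1 (q + 1)) (d2 : ∀ q, C2 q →ₗ[ℂ] C2 (q + 1))
    (f : ∀ q, C2 q →ₗ[ℂ] C1 (q + 1)) (t : ℝ) (q : ℕ) :
    defLap d1 d2 f t q = auxLap (defD d1 d2 f t) q := by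
  cases q <;> rfl

lemma defD_acyclic
    (d1 : ∀ q, C1 q →ₗ[ℂ] C1 (q + 1)) (d2 : ∀ q, C2 q →ₗ[ℂ] C2 (q + 1))
    (hdd1 : ∀ q, (d1 (q + 1)).comp (d1 q) = 0)
    (hdd2 : ∀ q, (d2 (q + 1)).comp (d2 q) = 0)
    (hac1 : LinearMap.ker (d1 0) = ⊥ ∧
      ∀ q, LinearMap.ker (d1 (q + 1)) = LinearMap.range (d1 q))
    (hac2 : LinearMap.ker (d2 0) = ⊥ ∧
      ∀ q, LinearMap.ker (d2 (q + 1)) = LinearMap.range (d2 q))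
    (f : ∀ q, C2 q →ₗ[ℂ] C1 (q + 1))
    (hf : ∀ q, (f (q + 1)).comp (d2 q) + (d1 (q + 1)).comp (f q) = 0) (t : ℝ) :
    (∀ q, defD d1 d2 f t (q + 1) ∘ₗ defD d1 d2 f t q = 0) ∧
    (LinearMap.ker (defD d1 d2 f t 0) = ⊥ ∧
      ∀ q, LinearMap.ker (defD d1 d2 f t (q + 1)) = LinearMap.range (defD d1 d2 f t q)) := by
  have e1 : ∀ q x, d1 (q + 1) (d1 q x) = 0 := fun q x => LinearMap.congr_fun (hdd1 q) x
  have e2 : ∀ q x, d2 (q + 1) (d2 q x) = 0 := fun q x => LinearMap.congr_fun (hdd2 q) x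
  have e3 : ∀ q x, f (q + 1) (d2 q x) = - d1 (q + 1) (f q x) := fun q x =>
    eq_neg_of_add_eq_zero_left (LinearMap.congr_fun (hf q) x)
  have hdd : ∀ q, defD d1 d2 f t (q + 1) ∘ₗ defD d1 d2 f t q = 0 := by
    intro q
    refine LinearMap.ext fun x => ?_
    rw [LinearMap.comp_apply, defD_apply, defD_apply]
    simp [e1, e2, e3]
  refine ⟨hdd, ?_, fun q => le_antisymm ?_ ?_⟩
  · rw [LinearMap.ker_eq_bot']
    intro x hx
    rw [defD_apply] at hx
    have ha : d1 0 x.fst + (t : ℂ) • f 0 x.snd = 0 := congrArg WithLp.fst hx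
    have hb : d2 0 x.snd = 0 := congrArg WithLp.snd hx
    have hb' := LinearMap.ker_eq_bot'.1 hac2.1 _ hb
    rw [hb', map_zero, smul_zero, add_zero] at ha
    have ha' := LinearMap.ker_eq_bot'.1 hac1.1 _ ha
    exact WithLp.ofLp_injective 2 (Prod.ext ha' hb')
  · intro x hx
    rw [LinearMap.mem_ker, defD_apply] at hx
    have ha : d1 (q + 1) x.fst + (t : ℂ) • f (q + 1) x.snd = 0 := congrArg WithLp.fst hx
    have hb : d2 (q + 1) x.snd = 0 := congrArg WithLp.snd hx
    have hb' : x.snd ∈ LinearMap.range (d2 q) := by rw [← hac2.2 q]; exact hb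
    obtain ⟨w, hw⟩ := hb'
    have ha' : x.fst - (t : ℂ) • f q w ∈ LinearMap.range (d1 q) := by
      rw [← hac1.2 q, LinearMap.mem_ker, map_sub, map_smul, ← ha, ← hw, e3]
      module
    obtain ⟨y, hy⟩ := ha'
    refine ⟨WithLp.toLp 2 (y, w), ?_⟩
    rw [defD_apply]
    refine WithLp.ofLp_injective 2 (Prod.ext ?_ hw)
    change d1 q y + (t : ℂ) • f q w = x.fst
    rw [hy]; simp
  · rintro _ ⟨x, rfl⟩
    exact LinearMap.congr_fun (hdd q) x

/-- The endomorphism `(u, v) ↦ (h v, 0)`. -/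
def auxH (h : ∀ q, C2 q →ₗ[ℂ] C1 q) (q : ℕ) : WithLp 2 (C1 q × C2 q) →ₗ[ℂ] WithLp 2 (C1 q × C2 q) :=
  (WithLp.linearEquiv 2 ℂ (C1 q × C2 q)).symm.toLinearMap ∘ₗ
    (LinearMap.inl ℂ (C1 q) (C2 q) ∘ₗ h q ∘ₗ LinearMap.snd ℂ (C1 q) (C2 q)) ∘ₗ
    (WithLp.linearEquiv 2 ℂ (C1 q × C2 q)).toLinearMap

lemma auxH_apply (h : ∀ q, C2 q →ₗ[ℂ] C1 q) (q : ℕ) (x : WithLp 2 (C1 q × C2 q)) :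
    auxH h q x = WithLp.toLp 2 (h q x.snd, 0) := rfl

lemma auxH_trace (h : ∀ q, C2 q →ₗ[ℂ] C1 q) (q : ℕ) :
    LinearMap.trace ℂ _ (auxH h q) = 0 := by
  have hn : IsNilpotent (auxH h q) := by
    refine ⟨2, LinearMap.ext fun x => ?_⟩
    rw [pow_two, Module.End.mul_apply, auxH_apply, auxH_apply]
    simp
  exact (LinearMap.isNilpotent_trace_of_isNilpotent hn).eq_zero

/-- **Appendix A of [BFK, "Relative torsion"]** (finite-dimensional case `𝒜 = ℂ`).
For acyclic complexes `(C¹, d₁)`, `(C², d₂)` of finite-dimensional complex inner product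
spaces and maps `f_i : C²_i → C¹_{i+1}` with `f_{i+1} d_{2,i} + d_{1,i+1} f_i = 0`, the
deformed complex `(C, d(t))`, `d_i(t)(u,v) = (d_{1,i} u + t f_i v, d_{2,i} v)`, is acyclic
for every `t`, and `L(t) = (1/2) Σ_q (-1)^{q+1} q log det Δ_q(t)` is differentiable with
`L'(t) = 0` for every `t`; in particular `L` is constant. -/
theorem deformed_torsion_constant (N : ℕ)
    (d1 : ∀ q, C1 q →ₗ[ℂ] C1 (q + 1)) (d2 : ∀ q, C2 q →ₗ[ℂ] C2 (q + 1))
    (hdd1 : ∀ q, (d1 (q + 1)).comp (d1 q) = 0)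
    (hdd2 : ∀ q, (d2 (q + 1)).comp (d2 q) = 0)
    (htriv1 : ∀ q, N < q → ∀ x : C1 q, x = 0)
    (htriv2 : ∀ q, N < q → ∀ x : C2 q, x = 0)
    (hac1 : LinearMap.ker (d1 0) = ⊥ ∧
      ∀ q, LinearMap.ker (d1 (q + 1)) = LinearMap.range (d1 q))
    (hac2 : LinearMap.ker (d2 0) = ⊥ ∧
      ∀ q, LinearMap.ker (d2 (q + 1)) = LinearMap.range (d2 q))
    (f : ∀ q, C2 q →ₗ[ℂ] C1 (q + 1))
    (hf : ∀ q, (f (q + 1)).comp (d2 q) + (d1 (q + 1)).comp (f q) = 0) :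
    (∀ t : ℝ, LinearMap.ker (defD d1 d2 f t 0) = ⊥ ∧
      ∀ q, LinearMap.ker (defD d1 d2 f t (q + 1)) = LinearMap.range (defD d1 d2 f t q)) ∧
    (∀ t : ℝ, HasDerivAt (defL N d1 d2 f) 0 t) ∧
    (∀ t s : ℝ, defL N d1 d2 f t = defL N d1 d2 f s) := by
  have hA := fun t => defD_acyclic d1 d2 hdd1 hdd2 hac1 hac2 f hf t
  obtain ⟨δ, hδ0, hδ⟩ := aux_contraction d2 hdd2 hac2
  let h : ∀ q, C2 q →ₗ[ℂ] C1 q := fun q => match q with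
    | 0 => 0
    | (q + 1) => -(f q ∘ₗ δ q)
  have hh : ∀ q v, d1 q (h q v) - h (q + 1) (d2 q v) = f q v := by
    intro q v
    cases q with
    | zero =>
      have := LinearMap.congr_fun hδ0 v
      simp only [LinearMap.comp_apply, LinearMap.id_apply] at this
      simp [h, this]
    | succ q =>
      have h1 := LinearMap.congr_fun (hδ q) v
      simp only [LinearMap.comp_apply, LinearMap.id_apply, LinearMap.add_apply] at h1
      have h2 := LinearMap.congr_fun (hf q) (δ q v)
      simp only [LinearMap.comp_apply, LinearMap.add_apply, LinearMap.zero_apply] at h2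
      have h3 := congrArg (f (q + 1)) h1
      rw [map_add] at h3
      simp only [h, LinearMap.neg_apply, LinearMap.comp_apply, map_neg]
      rw [← h3, eq_neg_of_add_eq_zero_left h2]
      abel
  let F : ∀ q, WithLp 2 (C1 q × C2 q) →ₗ[ℂ] WithLp 2 (C1 (q + 1) × C2 (q + 1)) :=
    fun q => defD (fun _ => 0) (fun _ => 0) f 1 q
  have hD : ∀ t : ℝ, HasDerivAt (defL N d1 d2 f) 0 t := by
    intro t
    have hF : ∀ q, F q = defD d1 d2 f t q ∘ₗ auxH h q - auxH h (q + 1) ∘ₗ defD d1 d2 f t q := by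
      intro q
      refine LinearMap.ext fun x => ?_
      simp only [F, LinearMap.sub_apply, LinearMap.comp_apply, defD_apply, auxH_apply]
      refine WithLp.ofLp_injective 2 (Prod.ext ?_ ?_)
      · have := hh q x.snd
        simp [← this]
      · simp
    have hd := aux_deriv N (defD d1 d2 f t) F (hA t).1
      (fun q hq x => WithLp.ofLp_injective 2
        (Prod.ext (htriv1 q hq x.fst) (htriv2 q hq x.snd))) (hA t).2
      (auxH h) (auxH_trace h) hF
    have e : ∀ s : ℝ, (fun q => defD d1 d2 f t q + (s : ℂ) • F q) = defD d1 d2 f (t + s) := by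
      intro s
      funext q
      refine LinearMap.ext fun x => ?_
      simp only [F, LinearMap.add_apply, LinearMap.smul_apply, defD_apply]
      refine WithLp.ofLp_injective 2 (Prod.ext ?_ ?_)
      · simp [add_smul, add_assoc]
      · simp
    have hd' : HasDerivAt (fun s : ℝ => defL N d1 d2 f (t + s)) 0 0 := by
      convert! hd using 1
      funext s
      simp only [defL, defLap_eq]
      simp only [e s]
    have := HasDerivAt.comp_sub_const (f := fun s : ℝ => defL N d1 d2 f (t + s)) t t
      (by rw [sub_self]; exact hd')
    simpa using this
  refine ⟨fun t => (hA t).2, hD, fun t s => ?_⟩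
  exact is_const_of_deriv_eq_zero (fun x => (hD x).differentiableAt) (fun x => (hD x).deriv) t s
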